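/- arXiv:0905.1082 — 2 statements merged into one kernel-verified Lean document; each statement's English description precedes it below -/
import Mathlib

section
/- Let k be a field of characteristic different from 2 and let m be an odd positive integer. Then the circle product (e_1e_2) ∘ (e_3e_4) ∘ ⋯ ∘ (e_{m−2}e_{m−1}) ∘ e_m equals 2^{(m−1)/2} · e_1 e_2 ⋯ e_m, which is nonzero in G(m). Consequently the polynomial x_1 ∘ ⋯ ∘ x_{(m+1)/2} is not an identity of G_0(m) (while all its values on G_0(m) are central in G_0(m)), i.e. it is a proper central polynomial of G_0(m). -/
noncomputable section

/-- The `i`-th variable `x_i` of the free unital associative algebra `k⟨X⟩`. -/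
def xx (k : Type*) [Field k] (i : ℕ) : FreeAlgebra k ℕ := FreeAlgebra.ι k i

/-- The `i`-th standard generator (1-indexed, for `1 ≤ i ≤ m`) of the Grassmann
(exterior) algebra `G(m) = ExteriorAlgebra k (Fin m → k)`. -/
def ee (k : Type*) [Field k] (m : ℕ) (i : ℕ) : ExteriorAlgebra k (Fin m → k) :=
  ExteriorAlgebra.ι k (fun j : Fin m => if (j : ℕ) + 1 = i then 1 else 0)

/-- `G_0(m)`: the nonunitary subalgebra of `G(m)` generated by `e_1, …, e_m`, i.e. the
`k`-span of all increasing products `e_{i_1} ⋯ e_{i_r}` with `r ≥ 1`. -/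
def G0 (k : Type*) [Field k] (m : ℕ) : Submodule k (ExteriorAlgebra k (Fin m → k)) :=
  Submodule.span k {u | ∃ r : ℕ, 1 ≤ r ∧ ∃ s : Fin r → ℕ, StrictMono s ∧
    (∀ a, 1 ≤ s a ∧ s a ≤ m) ∧ u = (List.ofFn fun a => ee k m (s a)).prod}

/-- The left-associated circle product `f 1 ∘ f 2 ∘ ⋯ ∘ f n`, where `x ∘ y = xy + yx`. -/
def circFold {A : Type*} [Ring A] (f : ℕ → A) (n : ℕ) : A :=
  (List.range (n - 1)).foldl (fun acc i => acc * f (i + 2) + f (i + 2) * acc) (f 1)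

section CircleProduct

theorem circFold_one {A : Type*} [Ring A] (f : ℕ → A) : circFold f 1 = f 1 := rfl

theorem circFold_add_two {A : Type*} [Ring A] (f : ℕ → A) (n : ℕ) :
    circFold f (n + 2) = circFold f (n + 1) * f (n + 2) + f (n + 2) * circFold f (n + 1) := by
  simp [circFold, List.range_succ]

theorem map_circFold {A B F : Type*} [Ring A] [Ring B] [FunLike F A B] [RingHomClass F A B]
    (φ : F) (f : ℕ → A) (n : ℕ) :
    φ (circFold f (n + 1)) = circFold (fun i => φ (f i)) (n + 1) := by
  induction n with
  | zero => rfl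
  | succ n ih => simp only [circFold_add_two, map_add, map_mul, ih]

theorem two_pow_mul_circ {A : Type*} [Ring A] {x y : A} (h : x * y = y * x) (n : ℕ) :
    2 ^ n * x * y + y * (2 ^ n * x) = 2 ^ (n + 1) * (x * y) := by
  have h2 : y * 2 ^ n = 2 ^ n * y := ((Commute.ofNat_right y 2).pow_right n).eq
  rw [← mul_assoc y, h2, mul_assoc, mul_assoc, ← h, ← two_mul, ← mul_assoc, ← pow_succ']

end CircleProduct

namespace ExteriorAlgebra

section Commutation

variable {R M : Type*} [CommRing R] [AddCommGroup M] [Module R M]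

theorem ι_mul_of_mem_exteriorPower {d : ℕ} (v : M) {x : ExteriorAlgebra R M}
    (hx : x ∈ ⋀[R]^d M) : ι R v * x = (-1) ^ d * (x * ι R v) := by
  induction hx using Submodule.pow_induction_on_left' with
  | algebraMap r => simp [Algebra.commutes]
  | add x y i hx hy ihx ihy => simp only [mul_add, add_mul, ihx, ihy]
  | mem_mul w hw i x hx ih =>
    obtain ⟨w, rfl⟩ := hw
    have h : ι R v * ι R w = -(ι R w * ι R v) := eq_neg_of_add_eq_zero_left (ι_add_mul_swap v w)
    have hc : ι R w * (-1) ^ i = (-1) ^ i * ι R w :=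
      ((Commute.neg_one_right (ι R w)).pow_right i).eq
    rw [← mul_assoc, h, neg_mul, mul_assoc, ih, ← mul_assoc, hc, pow_succ]
    simp [mul_assoc]

theorem mul_comm_of_mem_exteriorPower {c d : ℕ} {x y : ExteriorAlgebra R M}
    (hx : x ∈ ⋀[R]^c M) (hy : y ∈ ⋀[R]^d M) : x * y = (-1) ^ (c * d) * (y * x) := by
  induction hx using Submodule.pow_induction_on_left' with
  | algebraMap r => simp [Algebra.commutes]
  | add x z i hx hz ihx ihz => simp only [mul_add, add_mul, ihx, ihz]
  | mem_mul w hw i x hx ih =>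
    obtain ⟨w, rfl⟩ := hw
    have hc : ι R w * (-1) ^ (i * d) = (-1) ^ (i * d) * ι R w :=
      ((Commute.neg_one_right (ι R w)).pow_right _).eq
    rw [mul_assoc, ih, ← mul_assoc, hc, mul_assoc, ← mul_assoc (ι R w) y x,
      ι_mul_of_mem_exteriorPower w hy, Nat.succ_mul, pow_add]
    simp [mul_assoc]

variable (R M) in
/-- The span of the homogeneous elements whose degree satisfies `p`. -/
def degreeSpan (p : ℕ → Prop) : Submodule R (ExteriorAlgebra R M) :=
  Submodule.span R {x | ∃ d, p d ∧ x ∈ ⋀[R]^d M}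

theorem mem_degreeSpan {p : ℕ → Prop} {d : ℕ} (hd : p d) {x : ExteriorAlgebra R M}
    (hx : x ∈ ⋀[R]^d M) : x ∈ degreeSpan R M p :=
  Submodule.subset_span ⟨d, hd, hx⟩

theorem degreeSpan_mono {p q : ℕ → Prop} (h : ∀ d, p d → q d) :
    degreeSpan R M p ≤ degreeSpan R M q :=
  Submodule.span_mono fun _ ⟨d, hd, hx⟩ => ⟨d, h d hd, hx⟩

theorem mul_mem_degreeSpan {p q r : ℕ → Prop} (h : ∀ c d, p c → q d → r (c + d))
    {x y : ExteriorAlgebra R M} (hx : x ∈ degreeSpan R M p) (hy : y ∈ degreeSpan R M q) :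
    x * y ∈ degreeSpan R M r := by
  have hxy := Submodule.mul_mem_mul hx hy
  rw [degreeSpan, degreeSpan, Submodule.span_mul_span] at hxy
  refine Submodule.span_mono ?_ hxy
  rintro _ ⟨a, ⟨c, hc, ha⟩, b, ⟨d, hd, hb⟩, rfl⟩
  exact ⟨c + d, h c d hc hd, SetLike.mul_mem_graded ha hb⟩

theorem commute_of_mem_degreeSpan {p q : ℕ → Prop} (h : ∀ c d, p c → q d → Even (c * d))
    {x y : ExteriorAlgebra R M} (hx : x ∈ degreeSpan R M p) (hy : y ∈ degreeSpan R M q) :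
    x * y = y * x := by
  induction hx, hy using Submodule.span_induction₂ with
  | mem_mem a b ha hb =>
    obtain ⟨c, hc, ha⟩ := ha
    obtain ⟨d, hd, hb⟩ := hb
    rw [mul_comm_of_mem_exteriorPower ha hb, (h c d hc hd).neg_one_pow, one_mul]
  | zero_left => simp
  | zero_right => simp
  | add_left _ _ _ _ _ _ h₁ h₂ => simp only [add_mul, mul_add, h₁, h₂]
  | add_right _ _ _ _ _ _ h₁ h₂ => simp only [add_mul, mul_add, h₁, h₂]
  | smul_left _ _ _ _ _ h₁ => simp [h₁]
  | smul_right _ _ _ _ _ h₁ => simp [h₁]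

theorem circ_eq_zero_of_mem_degreeSpan {p q : ℕ → Prop} (h : ∀ c d, p c → q d → Odd (c * d))
    {x y : ExteriorAlgebra R M} (hx : x ∈ degreeSpan R M p) (hy : y ∈ degreeSpan R M q) :
    x * y + y * x = 0 := by
  rw [← eq_neg_iff_add_eq_zero]
  induction hx, hy using Submodule.span_induction₂ with
  | mem_mem a b ha hb =>
    obtain ⟨c, hc, ha⟩ := ha
    obtain ⟨d, hd, hb⟩ := hb
    rw [mul_comm_of_mem_exteriorPower ha hb, (h c d hc hd).neg_one_pow, neg_one_mul]
  | zero_left => simp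
  | zero_right => simp
  | add_left _ _ _ _ _ _ h₁ h₂ => simp only [add_mul, mul_add, h₁, h₂, neg_add]
  | add_right _ _ _ _ _ _ h₁ h₂ => simp only [add_mul, mul_add, h₁, h₂, neg_add]
  | smul_left _ _ _ _ _ h₁ => simp [h₁]
  | smul_right _ _ _ _ _ h₁ => simp [h₁]

theorem circFold_mem_degreeSpan_sup {f : ℕ → ExteriorAlgebra R M}
    (hf : ∀ i, f i ∈ degreeSpan R M (fun d => Even d ∧ 2 ≤ d) ⊔ degreeSpan R M Odd) (n : ℕ) :
    circFold f (n + 1) ∈ degreeSpan R M Even ⊔ degreeSpan R M (fun d => Odd d ∧ 2 * n + 1 ≤ d) := by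
  suffices h : circFold f (n + 1) ∈ degreeSpan R M (fun d => Even d ∧ 2 * n + 2 ≤ d) ⊔
      degreeSpan R M (fun d => Odd d ∧ 2 * n + 1 ≤ d) from
    sup_le_sup (degreeSpan_mono fun _ hd => hd.1) le_rfl h
  induction n with
  | zero =>
    have hle : degreeSpan R M Odd ≤ degreeSpan R M (fun d => Odd d ∧ 2 * 0 + 1 ≤ d) :=
      degreeSpan_mono fun _ hd => ⟨hd, hd.pos⟩
    exact sup_le_sup le_rfl hle (hf 1)
  | succ n ih =>
    obtain ⟨a, ha, b, hb, hab⟩ := Submodule.mem_sup.1 ih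
    obtain ⟨c, hc, d, hd, hcd⟩ := Submodule.mem_sup.1 (hf (n + 2))
    have hbd : b * d + d * b = 0 :=
      circ_eq_zero_of_mem_degreeSpan (fun _ _ hi hj => hi.1.mul hj) hb hd
    have hexp : circFold f (n + 1 + 1) =
        (a * c + c * a) + ((a * d + d * a) + (b * c + c * b)) + (b * d + d * b) := by
      rw [circFold_add_two, ← hab, ← hcd]
      noncomm_ring
    rw [hexp, hbd, add_zero]
    refine Submodule.add_mem_sup (add_mem ?_ ?_)
      (add_mem (add_mem ?_ ?_) (add_mem ?_ ?_))
    · exact mul_mem_degreeSpan (fun _ _ hi hj => ⟨hi.1.add hj.1, by omega⟩) ha hc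
    · exact mul_mem_degreeSpan (fun _ _ hi hj => ⟨hi.1.add hj.1, by omega⟩) hc ha
    · exact mul_mem_degreeSpan (fun _ _ hi hj => ⟨hi.1.add_odd hj, by have := hj.pos; omega⟩) ha hd
    · exact mul_mem_degreeSpan (fun _ _ hi hj => ⟨hi.add_even hj.1, by have := hi.pos; omega⟩) hd ha
    · exact mul_mem_degreeSpan (fun _ _ hi hj => ⟨hi.1.add_even hj.1, by omega⟩) hb hc
    · exact mul_mem_degreeSpan (fun _ _ hi hj => ⟨hi.1.add_odd hj.1, by omega⟩) hc hb

end Commutation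

section Field

variable {k : Type*} [Field k] {m : ℕ}

theorem degreeSpan_eq_bot {p : ℕ → Prop} (h : ∀ d, p d → m < d) :
    degreeSpan k (Fin m → k) p = ⊥ := by
  rw [degreeSpan, Submodule.span_eq_bot]
  rintro x ⟨d, hd, hx⟩
  have hfin : Module.finrank k (⋀[k]^d (Fin m → k)) = 0 := by
    rw [exteriorPower.finrank_eq, Module.finrank_fin_fun, Nat.choose_eq_zero_of_lt (h d hd)]
  rwa [Submodule.finrank_eq_zero.1 hfin, Submodule.mem_bot] at hx

theorem list_prod_map_ee_mem (l : List ℕ) :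
    (l.map (ee k m)).prod ∈ ⋀[k]^l.length (Fin m → k) := by
  induction l with
  | nil => simp
  | cons a l ih =>
    rw [List.map_cons, List.prod_cons, List.length_cons, exteriorPower, pow_succ']
    exact Submodule.mul_mem_mul ⟨_, rfl⟩ ih

theorem G0_le_degreeSpan : G0 k m ≤ degreeSpan k (Fin m → k) (1 ≤ ·) := by
  refine Submodule.span_mono ?_
  rintro _ ⟨r, hr, s, -, -, rfl⟩
  refine ⟨r, hr, ?_⟩
  have h := list_prod_map_ee_mem (k := k) (m := m) (List.ofFn s)
  rwa [List.map_ofFn, List.length_ofFn] at h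

theorem degreeSpan_one_le :
    degreeSpan k (Fin m → k) (1 ≤ ·) ≤
      degreeSpan k (Fin m → k) (fun d => Even d ∧ 2 ≤ d) ⊔ degreeSpan k (Fin m → k) Odd := by
  refine Submodule.span_le.2 ?_
  rintro x ⟨d, hd, hx⟩
  rcases Nat.even_or_odd d with h | h
  · refine Submodule.mem_sup_left (mem_degreeSpan (d := d) ⟨h, ?_⟩ hx)
    obtain ⟨c, rfl⟩ := h
    omega
  · exact Submodule.mem_sup_right (mem_degreeSpan h hx)

theorem circFold_commute_of_mem_G0 {n : ℕ} (hm : m ≤ 2 * n + 1)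
    {f : ℕ → ExteriorAlgebra k (Fin m → k)} (hf : ∀ i, f i ∈ G0 k m)
    {a : ExteriorAlgebra k (Fin m → k)} (ha : a ∈ G0 k m) :
    circFold f (n + 1) * a = a * circFold f (n + 1) := by
  obtain ⟨x, hx, y, hy, hxy⟩ := Submodule.mem_sup.1 <|
    circFold_mem_degreeSpan_sup (fun i => degreeSpan_one_le (G0_le_degreeSpan (hf i))) n
  have ha' := G0_le_degreeSpan ha
  have hbot : degreeSpan k (Fin m → k) (m < ·) = ⊥ := degreeSpan_eq_bot fun _ h => h
  have hya : y * a = 0 := by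
    rw [← Submodule.mem_bot k, ← hbot]
    exact mul_mem_degreeSpan (fun _ _ hi hj => by omega) hy ha'
  have hay : a * y = 0 := by
    rw [← Submodule.mem_bot k, ← hbot]
    exact mul_mem_degreeSpan (fun _ _ hi hj => by omega) ha' hy
  rw [← hxy, add_mul, mul_add, hya, hay,
    commute_of_mem_degreeSpan (fun _ _ hi _ => hi.mul_right _) hx ha']

theorem commute_list_prod_map_ee {l : List ℕ} (hl : Even l.length) (i : ℕ) :
    (l.map (ee k m)).prod * ee k m i = ee k m i * (l.map (ee k m)).prod := by
  rw [ee, ι_mul_of_mem_exteriorPower _ (list_prod_map_ee_mem l), hl.neg_one_pow, one_mul]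

theorem prod_ofFn_ee_ne_zero :
    (List.ofFn fun a : Fin m => ee k m ((a : ℕ) + 1)).prod ≠ 0 := by
  have h : (List.ofFn fun a : Fin m => ee k m ((a : ℕ) + 1)).prod =
      ιMulti k m (Pi.basisFun k (Fin m)) := by
    rw [ιMulti_apply]
    congr 2
    funext a
    rw [ee]
    congr 1
    funext j
    simp [Pi.single_apply, Fin.ext_iff]
  intro h0
  have h1 := liftAlternating_apply_ιMulti (R := k)
    (Pi.single m (Pi.basisFun k (Fin m)).det) (Pi.basisFun k (Fin m))
  rw [← h, h0, map_zero, Pi.single_eq_same, Module.Basis.det_self] at h1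
  exact zero_ne_one h1

/-- The product `e₁ ⋯ e_m` as a product over `List.range`. -/
theorem prod_ofFn_ee :
    (List.ofFn fun a : Fin m => ee k m ((a : ℕ) + 1)).prod =
      (((List.range m).map (· + 1)).map (ee k m)).prod := by
  rw [List.ofFn_eq_map, ← List.map_coe_finRange_eq_range, List.map_map, List.map_map]
  rfl

theorem circFold_ee_pairs {f : ℕ → ExteriorAlgebra k (Fin m → k)} {n : ℕ}
    (hf : ∀ i, 1 ≤ i → i ≤ n + 1 → f i = ee k m (2 * i - 1) * ee k m (2 * i)) :
    circFold f (n + 1) =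
      2 ^ n * (((List.range (2 * n + 2)).map (· + 1)).map (ee k m)).prod := by
  induction n with
  | zero => simp [circFold_one, hf 1, List.range_succ]
  | succ n ih =>
    rw [circFold_add_two, ih fun i h₁ h₂ => hf i h₁ (by omega), hf (n + 2) (by omega) (by omega)]
    have hc (i : ℕ) := commute_list_prod_map_ee (k := k) (m := m)
      (l := (List.range (2 * n + 2)).map (· + 1)) (by simp [parity_simps]) i
    have hlist : (((List.range (2 * (n + 1) + 2)).map (· + 1)).map (ee k m)).prod =
        (((List.range (2 * n + 2)).map (· + 1)).map (ee k m)).prod *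
          (ee k m (2 * (n + 2) - 1) * ee k m (2 * (n + 2))) := by
      rw [show 2 * (n + 1) + 2 = 2 * n + 2 + 1 + 1 by ring, List.range_succ, List.range_succ]
      simp only [List.map_append, List.prod_append, List.map_cons, List.map_nil, List.prod_cons,
        List.prod_nil, mul_one, mul_assoc]
      rfl
    rw [hlist, two_pow_mul_circ]
    rw [← mul_assoc, hc, mul_assoc, hc, mul_assoc]

theorem circFold_ee (n : ℕ) (f : ℕ → ExteriorAlgebra k (Fin (2 * n + 1) → k))
    (hf : ∀ i, 1 ≤ i → i ≤ n → f i = ee k (2 * n + 1) (2 * i - 1) * ee k (2 * n + 1) (2 * i))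
    (hlast : f (n + 1) = ee k (2 * n + 1) (2 * n + 1)) :
    circFold f (n + 1) =
      2 ^ n * (List.ofFn fun a : Fin (2 * n + 1) => ee k (2 * n + 1) ((a : ℕ) + 1)).prod := by
  rw [prod_ofFn_ee]
  cases n with
  | zero => simp [circFold_one, hlast]
  | succ n =>
    have hc := commute_list_prod_map_ee (k := k) (m := 2 * (n + 1) + 1)
      (l := (List.range (2 * n + 2)).map (· + 1)) (by simp [parity_simps]) (2 * (n + 1) + 1)
    have hlist : (((List.range (2 * (n + 1) + 1)).map (· + 1)).map (ee k (2 * (n + 1) + 1))).prod =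
        (((List.range (2 * n + 2)).map (· + 1)).map (ee k (2 * (n + 1) + 1))).prod *
          ee k (2 * (n + 1) + 1) (2 * (n + 1) + 1) := by
      rw [show List.range (2 * (n + 1) + 1) = List.range (2 * n + 2) ++ [2 * (n + 1)] from
        List.range_succ]
      simp only [List.map_append, List.prod_append, List.map_cons, List.map_nil, List.prod_singleton]
    rw [circFold_add_two, circFold_ee_pairs hf, hlast, hlist, two_pow_mul_circ hc]

theorem ee_mem_G0 {i : ℕ} (h₁ : 1 ≤ i) (h₂ : i ≤ m) : ee k m i ∈ G0 k m :=
  Submodule.subset_span ⟨1, le_rfl, fun _ => i, Subsingleton.strictMono _, fun _ => ⟨h₁, h₂⟩,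
    by simp⟩

theorem ee_mul_ee_mem_G0 {i j : ℕ} (h₁ : 1 ≤ i) (hij : i < j) (h₂ : j ≤ m) :
    ee k m i * ee k m j ∈ G0 k m := by
  refine Submodule.subset_span ⟨2, by omega, ![i, j], ?_, ?_, ?_⟩
  · simpa [Fin.strictMono_iff_lt_succ] using hij
  · simp only [Fin.forall_fin_two, Matrix.cons_val_zero, Matrix.cons_val_one]
    omega
  · simp

theorem ee_zero : ee k m 0 = 0 := by
  rw [ee, ι_eq_zero_iff]
  funext j
  simp

end Field

end ExteriorAlgebra

open ExteriorAlgebra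

/-- Let `k` be a field of characteristic `≠ 2` and `m` odd.  Then
`(e_1e_2) ∘ (e_3e_4) ∘ ⋯ ∘ (e_{m-2}e_{m-1}) ∘ e_m = 2^{(m-1)/2} e_1 e_2 ⋯ e_m ≠ 0`;
consequently `x_1 ∘ ⋯ ∘ x_{(m+1)/2}` is not an identity of `G_0(m)` while all of its
values on `G_0(m)` are central in `G_0(m)`. -/
theorem stmt12 (k : Type*) [Field k] (hchar : ringChar k ≠ 2) (m : ℕ)
    (hm : 1 ≤ m) (hodd : ¬ Even m) :
    circFold (fun i => if 2 * i + 1 ≤ m then ee k m (2 * i - 1) * ee k m (2 * i)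
        else ee k m m) ((m + 1) / 2) =
      (2 : ExteriorAlgebra k (Fin m → k)) ^ ((m - 1) / 2) *
        (List.ofFn fun a : Fin m => ee k m ((a : ℕ) + 1)).prod ∧
    circFold (fun i => if 2 * i + 1 ≤ m then ee k m (2 * i - 1) * ee k m (2 * i)
        else ee k m m) ((m + 1) / 2) ≠ 0 ∧
    ¬ (∀ φ : FreeAlgebra k ℕ →ₐ[k] ExteriorAlgebra k (Fin m → k),
        (∀ i, φ (xx k i) ∈ G0 k m) → φ (circFold (xx k) ((m + 1) / 2)) = 0) ∧
    (∀ φ : FreeAlgebra k ℕ →ₐ[k] ExteriorAlgebra k (Fin m → k),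
        (∀ i, φ (xx k i) ∈ G0 k m) →
        ∀ a ∈ G0 k m,
          φ (circFold (xx k) ((m + 1) / 2)) * a = a * φ (circFold (xx k) ((m + 1) / 2))) := by
  obtain ⟨n, rfl⟩ := Nat.not_even_iff_odd.1 hodd
  rw [show (2 * n + 1 + 1) / 2 = n + 1 by omega, show (2 * n + 1 - 1) / 2 = n by omega]
  set f : ℕ → ExteriorAlgebra k (Fin (2 * n + 1) → k) := fun i =>
    if 2 * i + 1 ≤ 2 * n + 1 then ee k (2 * n + 1) (2 * i - 1) * ee k (2 * n + 1) (2 * i)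
      else ee k (2 * n + 1) (2 * n + 1) with hf
  have heq := circFold_ee n f (fun i _ h => if_pos (by omega)) (if_neg (by omega))
  have hne : circFold f (n + 1) ≠ 0 := by
    have h2 : (2 : k) ^ n ≠ 0 := pow_ne_zero _ (Ring.two_ne_zero hchar)
    have hsmul : (2 : ExteriorAlgebra k (Fin (2 * n + 1) → k)) ^ n =
        algebraMap k _ ((2 : k) ^ n) := by
      rw [map_pow, map_ofNat]
    rw [heq, hsmul, ← Algebra.smul_def]
    exact smul_ne_zero h2 prod_ofFn_ee_ne_zero
  refine ⟨heq, hne, fun h => ?_, fun φ hφ a ha => ?_⟩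
  · have hφ (i : ℕ) : FreeAlgebra.lift k f (xx k i) = f i := FreeAlgebra.lift_ι_apply f i
    refine hne ?_
    rw [← h (FreeAlgebra.lift k f) fun i => ?_, map_circFold]
    · simp only [hφ]
    · rw [hφ]
      rcases Nat.eq_zero_or_pos i with rfl | hi
      · simp [hf, ee_zero]
      · simp only [hf]
        split_ifs with hle
        · exact ee_mul_ee_mem_G0 (by omega) (by omega) (by omega)
        · exact ee_mem_G0 hm le_rfl
  · rw [map_circFold]
    exact circFold_commute_of_mem_G0 le_rfl hφ ha

end
end

section
/- Let k be a field of characteristic different from 2 and let n ≥ 1 be an integer. Then in k⟨X⟩, the element x_1 ∘ x_2 ∘ ⋯ ∘ x_n is congruent, modulo the T-ideal T^(3) generated by [[x_1,x_2],x_3], to the sum over all subsets J of {1,…,n} of even cardinality 2s (0 ≤ s ≤ ⌊n/2⌋) of (−1)^s 2^{n−1−s} P_n(J) Q(J), where: P_n(J) = x_{i_1} x_{i_2} ⋯ x_{i_{n−2s}} with {1,…,n} \ J = {i_1 < i_2 < ⋯ < i_{n−2s}} (and P_n(J) = 1 if J = {1,…,n}), and Q(J) = ∏_{r=1}^{s}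 [x_{j_{2r−1}}, x_{j_{2r}}] with J = {j_1 < j_2 < ⋯ < j_{2s}} (and Q(∅) = 1). -/
noncomputable section

/-- Commutator `[a,b] = ab - ba`. -/
def brk {A : Type*} [Ring A] (a b : A) : A := a * b - b * a

/-- `Q` applied to a sorted list `j_1 < j_2 < ⋯ < j_{2s}`:
`[x_{j_1},x_{j_2}][x_{j_3},x_{j_4}] ⋯ [x_{j_{2s-1}},x_{j_{2s}}]`. -/
def Qlist (k : Type*) [Field k] : List ℕ → FreeAlgebra k ℕ
  | a :: b :: rest => brk (xx k a) (xx k b) * Qlist k rest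
  | _ => 1

/-- The summand indexed by `J`, with the list `l` of further indices appended to those of `J`
inside `Q`. -/
def circTerm (k : Type*) [Field k] (n : ℕ) (J : Finset ℕ) (l : List ℕ) : FreeAlgebra k ℕ :=
  ((-1 : k) ^ (J.card / 2) * 2 ^ (n - 1 - J.card / 2)) •
    ((((Finset.Icc 1 n \ J).sort (· ≤ ·)).map (xx k)).prod * Qlist k (J.sort (· ≤ ·) ++ l))

/-- The sum of `circTerm` over the subsets of `{1,…,n}` of even cardinality. -/
def evenSum (k : Type*) [Field k] (n : ℕ) : FreeAlgebra k ℕ :=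
  ∑ J ∈ (Finset.Icc 1 n).powerset, if Even J.card then circTerm k n J [] else 0

/-- The sum of `circTerm` over the subsets of `{1,…,n}` of odd cardinality, with the index `m`
appended in `Q`. -/
def oddSum (k : Type*) [Field k] (n m : ℕ) : FreeAlgebra k ℕ :=
  ∑ J ∈ (Finset.Icc 1 n).powerset, if Even J.card then 0 else circTerm k n J [m]

theorem Finset.sort_insert_of_forall_lt {J : Finset ℕ} {a : ℕ} (h : ∀ b ∈ J, b < a) :
    (insert a J).sort (· ≤ ·) = J.sort (· ≤ ·) ++ [a] := by
  have ha : a ∉ J := fun h' => lt_irrefl _ (h a h')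
  refine List.Perm.eq_of_pairwise' (r := (· ≤ ·)) (Finset.pairwise_sort _ _) ?_ ?_
  · rw [List.pairwise_append]
    refine ⟨Finset.pairwise_sort _ _, List.pairwise_singleton _ _, ?_⟩
    intro b hb c hc
    rw [List.mem_singleton] at hc
    subst hc
    exact (h b ((Finset.mem_sort _).1 hb)).le
  · rw [List.perm_ext_iff_of_nodup (Finset.sort_nodup _ _)]
    · intro b
      simp [or_comm]
    · simp [List.nodup_append, ha]

theorem Finset.lt_of_mem_of_subset_Icc {n b : ℕ} {J : Finset ℕ} (hJ : J ⊆ Finset.Icc 1 n)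
    (hb : b ∈ J) : b < n + 1 :=
  Nat.lt_succ_of_le (Finset.mem_Icc.1 (hJ hb)).2

theorem sort_Icc_succ_sdiff {n : ℕ} {J : Finset ℕ} (hJ : J ⊆ Finset.Icc 1 n) :
    (Finset.Icc 1 (n + 1) \ J).sort (· ≤ ·) =
      (Finset.Icc 1 n \ J).sort (· ≤ ·) ++ [n + 1] := by
  have hn : n + 1 ∉ J := fun h => lt_irrefl _ (Finset.lt_of_mem_of_subset_Icc hJ h)
  rw [← Finset.sort_insert_of_forall_lt fun b hb =>
      Finset.lt_of_mem_of_subset_Icc Finset.sdiff_subset hb,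
    ← Finset.insert_Icc_right_eq_Icc_add_one (by omega), Finset.insert_sdiff_of_notMem _ hn]

theorem Icc_succ_sdiff_insert (n : ℕ) (J : Finset ℕ) :
    Finset.Icc 1 (n + 1) \ insert (n + 1) J = Finset.Icc 1 n \ J := by
  ext b
  simp only [Finset.mem_sdiff, Finset.mem_Icc, Finset.mem_insert]
  grind

theorem sum_powerset_Icc_succ {M : Type*} [AddCommMonoid M] (n : ℕ) (f : Finset ℕ → M) :
    ∑ J ∈ (Finset.Icc 1 (n + 1)).powerset, f J =
      ∑ J ∈ (Finset.Icc 1 n).powerset, (f J + f (insert (n + 1) J)) := by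
  rw [← Finset.insert_Icc_right_eq_Icc_add_one (by omega),
    Finset.sum_powerset_insert (by simp), Finset.sum_add_distrib]

section LieNilpotent

variable {k A : Type*} [Field k] [Ring A] [Algebra k A]

theorem Qlist_append (l l' : List ℕ) (hl : Even l.length) :
    Qlist k (l ++ l') = Qlist k l * Qlist k l' := by
  induction l using Qlist.induct with
  | case1 a b rest ih =>
    have h : Even rest.length := by simpa [Nat.even_add_one] using hl
    simp [Qlist, ih h, mul_assoc]
  | case2 l h =>
    match l, h with
    | [], _ => simp [Qlist]
    | [a], _ => simp at hl
    | a :: b :: r, h => exact (h a b r rfl).elim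

theorem Qlist_append_singleton (l : List ℕ) (m : ℕ) (hl : Even l.length) :
    Qlist k (l ++ [m]) = Qlist k l := by
  simp [Qlist_append l [m] hl, Qlist]

theorem commute_brk (hA : ∀ a b c : A, brk (brk a b) c = 0) (a b c : A) :
    Commute (brk a b) c :=
  sub_eq_zero.1 (hA a b c)

theorem map_brk {B : Type*} [Ring B] [Algebra k B] (π : B →ₐ[k] A) (a b : B) :
    π (brk a b) = brk (π a) (π b) := by
  simp [brk]

variable (π : FreeAlgebra k ℕ →ₐ[k] A)

theorem commute_map_Qlist (hA : ∀ a b c : A, brk (brk a b) c = 0) (l : List ℕ) (a : A) :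
    Commute (π (Qlist k l)) a := by
  induction l using Qlist.induct with
  | case1 b c rest ih =>
    rw [Qlist, map_mul, map_brk]
    exact (commute_brk hA _ _ _).mul_left ih
  | case2 l h =>
    rw [Qlist.eq_2 _ _ h, map_one]
    exact Commute.one_left a

/-- Enlarging `n` without enlarging `J` doubles the summand and multiplies it by `x_{n+1}`. -/
theorem map_circTerm_succ (hA : ∀ a b c : A, brk (brk a b) c = 0) {n : ℕ} (hn : 1 ≤ n)
    {J : Finset ℕ} (hJ : J ⊆ Finset.Icc 1 n) (l : List ℕ) :
    π (circTerm k (n + 1) J l) = (2 : k) • (π (circTerm k n J l) * π (xx k (n + 1))) := by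
  have hc : J.card ≤ n := by simpa using Finset.card_le_card hJ
  have he : n + 1 - 1 - J.card / 2 = n - 1 - J.card / 2 + 1 := by omega
  rw [circTerm, circTerm, sort_Icc_succ_sdiff hJ, he]
  simp only [List.map_append, List.map_cons, List.map_nil, List.prod_append, List.prod_cons,
    List.prod_nil, mul_one, map_smul, map_mul, smul_mul_assoc, smul_smul]
  congr 1
  · ring
  · rw [mul_assoc, mul_assoc, (commute_map_Qlist π hA _ _).eq]

theorem circTerm_succ_insert_of_odd {n : ℕ} {J : Finset ℕ} (hJ : J ⊆ Finset.Icc 1 n)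
    (ho : ¬ Even J.card) :
    circTerm k (n + 1) (insert (n + 1) J) [] = -circTerm k n J [n + 1] := by
  have hlt : ∀ b ∈ J, b < n + 1 := fun b hb => Finset.lt_of_mem_of_subset_Icc hJ hb
  have hmem : n + 1 ∉ J := fun h => lt_irrefl _ (hlt _ h)
  rw [Nat.not_even_iff_odd] at ho
  obtain ⟨s, hs⟩ := ho
  have e1 : (2 * s + 1 + 1) / 2 = s + 1 := by omega
  have e2 : (2 * s + 1) / 2 = s := by omega
  have e3 : n + 1 - 1 - (s + 1) = n - 1 - s := by omega
  rw [circTerm, circTerm, Icc_succ_sdiff_insert, Finset.sort_insert_of_forall_lt hlt,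
    Finset.card_insert_of_notMem hmem, hs, e1, e2, e3, List.append_nil, ← neg_smul]
  congr 1
  ring

theorem map_circTerm_succ_insert_of_even {n : ℕ} (hn : 1 ≤ n) {J : Finset ℕ}
    (hJ : J ⊆ Finset.Icc 1 n) (he : Even J.card) (m : ℕ) :
    π (circTerm k (n + 1) (insert (n + 1) J) [m]) =
      (2 : k) • (π (circTerm k n J []) * brk (π (xx k (n + 1))) (π (xx k m))) := by
  have hlt : ∀ b ∈ J, b < n + 1 := fun b hb => Finset.lt_of_mem_of_subset_Icc hJ hb
  have hmem : n + 1 ∉ J := fun h => lt_irrefl _ (hlt _ h)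
  have hc : J.card ≤ n := by simpa using Finset.card_le_card hJ
  have hl : Even (J.sort (· ≤ ·)).length := by rwa [Finset.length_sort]
  obtain ⟨s, hs⟩ := he
  have e1 : (s + s + 1) / 2 = s := by omega
  have e2 : (s + s) / 2 = s := by omega
  have e3 : n + 1 - 1 - s = n - 1 - s + 1 := by omega
  rw [circTerm, circTerm, Icc_succ_sdiff_insert, Finset.sort_insert_of_forall_lt hlt,
    Finset.card_insert_of_notMem hmem, hs, e1, e2, e3, List.append_nil, List.append_assoc,
    Qlist_append _ _ hl]
  simp only [List.singleton_append, Qlist, mul_one, map_smul, map_mul, map_brk, smul_mul_assoc,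
    smul_smul, mul_assoc]
  congr 1
  ring

theorem map_evenSum_succ (hA : ∀ a b c : A, brk (brk a b) c = 0) {n : ℕ} (hn : 1 ≤ n) :
    π (evenSum k (n + 1)) =
      (2 : k) • (π (evenSum k n) * π (xx k (n + 1))) - π (oddSum k n (n + 1)) := by
  simp only [evenSum, oddSum, sum_powerset_Icc_succ, map_sum, Finset.sum_mul, Finset.smul_sum,
    ← Finset.sum_sub_distrib]
  refine Finset.sum_congr rfl fun J hJ => ?_
  rw [Finset.mem_powerset] at hJ
  have hmem : n + 1 ∉ J := fun h => lt_irrefl _ (Finset.lt_of_mem_of_subset_Icc hJ h)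
  rw [Finset.card_insert_of_notMem hmem]
  by_cases h : Even J.card
  · simp [h, Nat.even_add_one, map_circTerm_succ π hA hn hJ]
  · simp [h, Nat.even_add_one, circTerm_succ_insert_of_odd hJ h]

theorem map_oddSum_succ (hA : ∀ a b c : A, brk (brk a b) c = 0) {n : ℕ} (hn : 1 ≤ n) (m : ℕ) :
    π (oddSum k (n + 1) m) = (2 : k) • (π (oddSum k n m) * π (xx k (n + 1))) +
      (2 : k) • (π (evenSum k n) * brk (π (xx k (n + 1))) (π (xx k m))) := by
  simp only [evenSum, oddSum, sum_powerset_Icc_succ, map_sum, Finset.sum_mul, Finset.smul_sum,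
    ← Finset.sum_add_distrib]
  refine Finset.sum_congr rfl fun J hJ => ?_
  rw [Finset.mem_powerset] at hJ
  have hmem : n + 1 ∉ J := fun h => lt_irrefl _ (Finset.lt_of_mem_of_subset_Icc hJ h)
  rw [Finset.card_insert_of_notMem hmem]
  by_cases h : Even J.card
  · simp [h, Nat.even_add_one, map_circTerm_succ_insert_of_even π hn hJ h]
  · simp [h, Nat.even_add_one, map_circTerm_succ π hA hn hJ]

theorem evenSum_one : evenSum k 1 = xx k 1 := by
  have h := sum_powerset_Icc_succ 0 fun J => if Even J.card then circTerm k 1 J [] else 0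
  simpa [evenSum, circTerm, Qlist] using h

theorem oddSum_one (m : ℕ) : oddSum k 1 m = brk (xx k 1) (xx k m) := by
  have h := sum_powerset_Icc_succ 0 fun J => if Even J.card then 0 else circTerm k 1 J [m]
  simpa [oddSum, circTerm, Qlist] using h

theorem brk_map_evenSum (hA : ∀ a b c : A, brk (brk a b) c = 0) {n : ℕ} (hn : 1 ≤ n) (m : ℕ) :
    brk (π (evenSum k n)) (π (xx k m)) = π (oddSum k n m) := by
  induction n, hn using Nat.le_induction generalizing m with
  | base => rw [evenSum_one, oddSum_one, map_brk]
  | succ n hn ih =>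
    have hc := hA (π (evenSum k n)) (π (xx k (n + 1))) (π (xx k m))
    rw [ih] at hc
    rw [map_evenSum_succ π hA hn, map_oddSum_succ π hA hn, ← ih m]
    have hx := (commute_brk hA (π (evenSum k n)) (π (xx k m)) (π (xx k (n + 1)))).eq
    simp only [brk, two_smul] at hc hx ⊢
    have hc' := sub_eq_zero.1 hc
    simp only [sub_mul, mul_sub, add_mul, mul_add, mul_assoc] at hx hc' ⊢
    rw [hc']
    abel_nf

theorem circFold_succ (f : ℕ → A) {n : ℕ} (hn : 1 ≤ n) :
    circFold f (n + 1) = circFold f n * f (n + 1) + f (n + 1) * circFold f n := by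
  obtain ⟨n, rfl⟩ := Nat.exists_eq_add_of_le' hn
  simp [circFold, List.range_succ]

theorem map_circFold_s13 (hA : ∀ a b c : A, brk (brk a b) c = 0) {n : ℕ} (hn : 1 ≤ n) :
    π (circFold (xx k) n) = π (evenSum k n) := by
  induction n, hn using Nat.le_induction with
  | base => simp [circFold, evenSum_one]
  | succ n hn ih =>
    rw [circFold_succ _ hn, map_add, map_mul, map_mul, ih, map_evenSum_succ π hA hn,
      ← brk_map_evenSum π hA hn, brk, two_smul]
    abel

end LieNilpotent

/-- The T-ideal `T^(3)`. -/
def tIdealThree (k : Type*) [Field k] : TwoSidedIdeal (FreeAlgebra k ℕ) :=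
  let S := Submodule.span k {y : FreeAlgebra k ℕ | ∃ a w b : FreeAlgebra k ℕ,
    (∃ ψ : FreeAlgebra k ℕ →ₐ[k] FreeAlgebra k ℕ,
      w = ψ (brk (brk (xx k 1) (xx k 2)) (xx k 3))) ∧ y = a * w * b}
  TwoSidedIdeal.mk' S S.zero_mem S.add_mem S.neg_mem
    (by
      intro x y hy
      refine Submodule.span_induction (p := fun y _ => x * y ∈ S) ?_ (by simp) ?_ ?_ hy
      · rintro _ ⟨a, w, b, hw, rfl⟩
        exact Submodule.subset_span ⟨x * a, w, b, hw, by simp only [mul_assoc]⟩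
      · intro u v _ _ hu hv
        rw [mul_add]
        exact S.add_mem hu hv
      · intro c u _ hu
        rw [mul_smul_comm]
        exact S.smul_mem c hu)
    (by
      intro y x hy
      refine Submodule.span_induction (p := fun y _ => y * x ∈ S) ?_ (by simp) ?_ ?_ hy
      · rintro _ ⟨a, w, b, hw, rfl⟩
        exact Submodule.subset_span ⟨a, w, b * x, hw, by simp only [mul_assoc]⟩
      · intro u v _ _ hu hv
        rw [add_mul]
        exact S.add_mem hu hv
      · intro c u _ hu
        rw [smul_mul_assoc]
        exact S.smul_mem c hu)

theorem mem_tIdealThree {k : Type*} [Field k] {x : FreeAlgebra k ℕ} :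
    x ∈ tIdealThree k ↔
      x ∈ Submodule.span k {y : FreeAlgebra k ℕ | ∃ a w b : FreeAlgebra k ℕ,
        (∃ ψ : FreeAlgebra k ℕ →ₐ[k] FreeAlgebra k ℕ,
          w = ψ (brk (brk (xx k 1) (xx k 2)) (xx k 3))) ∧ y = a * w * b} := by
  rw [tIdealThree, TwoSidedIdeal.mem_mk', SetLike.mem_coe]

theorem brk_brk_mem_tIdealThree {k : Type*} [Field k] (a b c : FreeAlgebra k ℕ) :
    brk (brk a b) c ∈ tIdealThree k := by
  refine mem_tIdealThree.2 (Submodule.subset_span ⟨1, _, 1,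
    ⟨FreeAlgebra.lift k fun i => if i = 1 then a else if i = 2 then b else c, rfl⟩, ?_⟩)
  simp [map_brk, xx]

/-- The projection of the free algebra onto its quotient by `T^(3)`. -/
def tIdealThreeMk (k : Type*) [Field k] :
    FreeAlgebra k ℕ →ₐ[k] (tIdealThree k).ringCon.Quotient :=
  (tIdealThree k).ringCon.mkₐ k

theorem tIdealThreeMk_eq_zero {k : Type*} [Field k] {x : FreeAlgebra k ℕ} :
    tIdealThreeMk k x = 0 ↔ x ∈ tIdealThree k := by
  rw [TwoSidedIdeal.mem_iff]
  exact RingCon.eq _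

theorem brk_brk_quotient_tIdealThree {k : Type*} [Field k]
    (a b c : (tIdealThree k).ringCon.Quotient) : brk (brk a b) c = 0 := by
  have hs : Function.Surjective (tIdealThreeMk k) := (tIdealThree k).ringCon.mkₐ_surjective
  obtain ⟨a, rfl⟩ := hs a
  obtain ⟨b, rfl⟩ := hs b
  obtain ⟨c, rfl⟩ := hs c
  rw [← map_brk, ← map_brk, tIdealThreeMk_eq_zero]
  exact brk_brk_mem_tIdealThree a b c

/-- Let `k` be a field of characteristic `≠ 2` and `n ≥ 1`.  Modulo the
T-ideal `T^(3)` generated by `[[x_1,x_2],x_3]`, `x_1 ∘ ⋯ ∘ x_n` is congruent to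
`∑_{J ⊆ {1,…,n}, |J| = 2s even} (-1)^s 2^{n-1-s} P_n(J) Q(J)`. -/
theorem stmt13 (k : Type*) [Field k] (hchar : ringChar k ≠ 2) (n : ℕ) (hn : 1 ≤ n) :
    circFold (xx k) n -
      ∑ J ∈ (Finset.Icc 1 n).powerset.filter (fun J => Even J.card),
        ((-1 : k) ^ (J.card / 2) * 2 ^ (n - 1 - J.card / 2)) •
          ((((Finset.Icc 1 n \ J).sort (· ≤ ·)).map (xx k)).prod *
            Qlist k (J.sort (· ≤ ·)))
    ∈ Submodule.span k {y : FreeAlgebra k ℕ | ∃ a w b : FreeAlgebra k ℕ,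
        (∃ ψ : FreeAlgebra k ℕ →ₐ[k] FreeAlgebra k ℕ,
          w = ψ (brk (brk (xx k 1) (xx k 2)) (xx k 3))) ∧ y = a * w * b} := by
  rw [← mem_tIdealThree, ← tIdealThreeMk_eq_zero, map_sub,
    map_circFold_s13 _ brk_brk_quotient_tIdealThree hn, ← map_sub]
  simp [evenSum, circTerm, Finset.sum_filter]

end
end
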